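/- arXiv:0812.3807 — 3 statements merged into one kernel-verified Lean document; each statement's English description precedes it below -/
import Mathlib

section
/- Let R be a Noetherian commutative ring and G a finitely generated R-module. Then G is totally reflexive if and only if G is reflexive (the canonical map G → Hom_R(Hom_R(G,R),R) is an isomorphism) and Ext^i_R(G,R) = 0 = Ext^i_R(Hom_R(G,R),R) for all i ≥ 1. -/
universe u

open TensorProduct

/-- A `ℤ`-indexed chain complex of `R`-modules: modules `X i` with
differentials `d i : X (i+1) →ₗ[R] X i` satisfying `d ∘ d = 0`. -/
structure ModComplex (R : Type u) [CommRing R] : Type (u + 1) where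
  X : ℤ → Type u
  [addCommGroup : ∀ i, AddCommGroup (X i)]
  [module : ∀ i, Module R (X i)]
  d : ∀ i : ℤ, X (i + 1) →ₗ[R] X i
  dd : ∀ i : ℤ, (d i).comp (d (i + 1)) = 0

attribute [instance] ModComplex.addCommGroup ModComplex.module

namespace ModComplex

variable {R : Type u} [CommRing R] (L : ModComplex R)

/-- The complex is acyclic: exact at every spot. -/
def Acyclic : Prop := ∀ i : ℤ, Function.Exact (L.d (i + 1)) (L.d i)

/-- The complex `Hom_R(L, N)` is acyclic. -/
def HomAcyclic (N : Type u) [AddCommGroup N] [Module R N] : Prop :=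
  ∀ i : ℤ, Function.Exact
    (fun φ : L.X i →ₗ[R] N => φ.comp (L.d i))
    (fun φ : L.X (i + 1) →ₗ[R] N => φ.comp (L.d (i + 1)))

/-- The complex `Hom_R(E, L)` is acyclic. -/
def CoHomAcyclic (E : Type u) [AddCommGroup E] [Module R E] : Prop :=
  ∀ i : ℤ, Function.Exact
    (fun φ : E →ₗ[R] L.X (i + 1 + 1) => (L.d (i + 1)).comp φ)
    (fun φ : E →ₗ[R] L.X (i + 1) => (L.d i).comp φ)

/-- The complex `E ⊗_R L` is acyclic. -/
def TensorAcyclic (E : Type u) [AddCommGroup E] [Module R E] : Prop :=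
  ∀ i : ℤ, Function.Exact
    (LinearMap.lTensor E (L.d (i + 1)))
    (LinearMap.lTensor E (L.d i))

/-- The complex consists of finitely generated projective modules. -/
def FGProj : Prop :=
  ∀ i : ℤ, Module.Finite R (L.X i) ∧ Module.Projective R (L.X i)

/-- A totally acyclic complex: an acyclic complex of finitely generated
projective modules such that `Hom_R(L, R)` is acyclic. -/
def TotallyAcyclic : Prop := L.Acyclic ∧ L.FGProj ∧ L.HomAcyclic R

end ModComplex

/-- `M` is (isomorphic to) the cokernel of the differential `d 0 : X 1 → X 0`. -/
def IsCokerOf {R : Type u} [CommRing R] (L : ModComplex R)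
    (M : Type u) [AddCommGroup M] [Module R M] : Prop :=
  ∃ f : L.X 0 →ₗ[R] M, Function.Surjective f ∧ LinearMap.ker f = LinearMap.range (L.d 0)

/-- `M` is (isomorphic to) the kernel of the differential `d 0 : X 1 → X 0`. -/
def IsKerOf {R : Type u} [CommRing R] (L : ModComplex R)
    (M : Type u) [AddCommGroup M] [Module R M] : Prop :=
  ∃ f : M →ₗ[R] L.X 1, Function.Injective f ∧ LinearMap.range f = LinearMap.ker (L.d 0)

/-- `M` is totally reflexive: it is a cokernel of a differential in a totally
acyclic complex of finitely generated projective modules. -/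
def IsTotallyReflexive (R : Type u) [CommRing R]
    (M : Type u) [AddCommGroup M] [Module R M] : Prop :=
  ∃ L : ModComplex R, L.TotallyAcyclic ∧ IsCokerOf L M

/-- Gorenstein projective module. -/
def IsGorensteinProjective (R : Type u) [CommRing R]
    (A : Type u) [AddCommGroup A] [Module R A] : Prop :=
  ∃ L : ModComplex R, L.Acyclic ∧ (∀ i, Module.Projective R (L.X i)) ∧
    (∀ (Q : Type u) [AddCommGroup Q] [Module R Q],
      Module.Projective R Q → L.HomAcyclic Q) ∧
    IsCokerOf L A

/-- Gorenstein injective module. -/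
def IsGorensteinInjective (R : Type u) [CommRing R]
    (B : Type u) [AddCommGroup B] [Module R B] : Prop :=
  ∃ L : ModComplex R, L.Acyclic ∧ (∀ i, Module.Injective R (L.X i)) ∧
    (∀ (E : Type u) [AddCommGroup E] [Module R E],
      Module.Injective R E → L.CoHomAcyclic E) ∧
    IsKerOf L B

/-- Gorenstein flat module. -/
def IsGorensteinFlat (R : Type u) [CommRing R]
    (M : Type u) [AddCommGroup M] [Module R M] : Prop :=
  ∃ L : ModComplex R, L.Acyclic ∧ (∀ i, Module.Flat R (L.X i)) ∧
    (∀ (E : Type u) [AddCommGroup E] [Module R E],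
      Module.Injective R E → L.TensorAcyclic E) ∧
    IsCokerOf L M

/-- `M` has projective dimension at most `n`. -/
def ProjDimLe (R : Type u) [CommRing R] :
    ℕ → ∀ (M : Type u) [AddCommGroup M] [Module R M], Prop
  | 0, M, _, _ => Module.Projective R M
  | n + 1, M, _, _ =>
    ∃ (P : Type u) (_ : AddCommGroup P) (_ : Module R P) (f : P →ₗ[R] M),
      Module.Projective R P ∧ Function.Surjective f ∧
        ProjDimLe R n (LinearMap.ker f)

/-- `M` has flat dimension at most `n`. -/
def FlatDimLe (R : Type u) [CommRing R] :
    ℕ → ∀ (M : Type u) [AddCommGroup M] [Module R M], Prop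
  | 0, M, _, _ => Module.Flat R M
  | n + 1, M, _, _ =>
    ∃ (F : Type u) (_ : AddCommGroup F) (_ : Module R F) (f : F →ₗ[R] M),
      Module.Flat R F ∧ Function.Surjective f ∧
        FlatDimLe R n (LinearMap.ker f)

/-- `M` has Gorenstein projective dimension at most `n`. -/
def GProjDimLe (R : Type u) [CommRing R] :
    ℕ → ∀ (M : Type u) [AddCommGroup M] [Module R M], Prop
  | 0, M, _, _ => IsGorensteinProjective R M
  | n + 1, M, _, _ =>
    ∃ (P : Type u) (_ : AddCommGroup P) (_ : Module R P) (f : P →ₗ[R] M),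
      IsGorensteinProjective R P ∧ Function.Surjective f ∧
        GProjDimLe R n (LinearMap.ker f)

/-- The projective dimension, as an element of `ℕ∞`. -/
noncomputable def projDim (R : Type u) [CommRing R]
    (M : Type u) [AddCommGroup M] [Module R M] : ℕ∞ :=
  sInf {n : ℕ∞ | ∃ m : ℕ, n = m ∧ ProjDimLe R m M}

/-- The Gorenstein projective dimension, as an element of `ℕ∞`. -/
noncomputable def gProjDim (R : Type u) [CommRing R]
    (M : Type u) [AddCommGroup M] [Module R M] : ℕ∞ :=
  sInf {n : ℕ∞ | ∃ m : ℕ, n = m ∧ GProjDimLe R m M}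

open CategoryTheory


/-- A resolution by finitely generated projectives. -/
structure FRes (R : Type u) [CommRing R] (M : Type u) [AddCommGroup M] [Module R M] :
    Type (u + 1) where
  X : ℕ → Type u
  [addCommGroup : ∀ i, AddCommGroup (X i)]
  [module : ∀ i, Module R (X i)]
  fin : ∀ i, Module.Finite R (X i)
  proj : ∀ i, Module.Projective R (X i)
  d : ∀ i : ℕ, X (i + 1) →ₗ[R] X i
  ε : X 0 →ₗ[R] M
  surj : Function.Surjective ε
  exact0 : Function.Exact (d 0) ε
  exact : ∀ i, Function.Exact (d (i + 1)) (d i)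

attribute [instance] FRes.addCommGroup FRes.module FRes.fin FRes.proj

namespace FRes

variable {R : Type u} [CommRing R] {M : Type u} [AddCommGroup M] [Module R M] (F : FRes R M)

noncomputable def cx : ChainComplex (ModuleCat.{u} R) ℕ :=
  ChainComplex.of (fun n => ModuleCat.of R (F.X n)) (fun n => ModuleCat.ofHom (F.d n))
    (fun n => by
      ext x
      exact (F.exact n).apply_apply_eq_zero x)

lemma cx_d (n : ℕ) : F.cx.d (n + 1) n = ModuleCat.ofHom (F.d n) :=
  ChainComplex.of_d (fun n => ModuleCat.of R (F.X n)) (fun n => ModuleCat.ofHom (F.d n)) n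

lemma cx_exactAt_succ (n : ℕ) : F.cx.ExactAt (n + 1) := by
  rw [HomologicalComplex.exactAt_iff' _ (n + 1 + 1) (n + 1) n (by simp) (by simp)]
  rw [ShortComplex.ShortExact.moduleCat_exact_iff_function_exact]
  change Function.Exact (F.cx.d (n+1+1) (n+1)) (F.cx.d (n+1) n)
  rw [cx_d, cx_d]
  exact F.exact n

lemma cx_w : F.cx.d 1 0 ≫ (ModuleCat.ofHom F.ε : F.cx.X 0 ⟶ ModuleCat.of R M) = 0 := by
  rw [show F.cx.d 1 0 = _ from F.cx_d 0]
  ext x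
  exact F.exact0.apply_apply_eq_zero x

noncomputable def res : ProjectiveResolution (ModuleCat.of R M) where
  complex := F.cx
  projective n := (IsProjective.iff_projective (R := R) (F.X n)).1 (F.proj n)
  π := (ChainComplex.toSingle₀Equiv _ _).symm ⟨(ModuleCat.ofHom F.ε : F.cx.X 0 ⟶ ModuleCat.of R M), F.cx_w⟩
  quasiIso := ⟨fun n => by
    cases n
    · rw [ChainComplex.quasiIsoAt₀_iff, ShortComplex.quasiIso_iff_of_zeros']
      · refine (ShortComplex.exact_and_epi_g_iff_of_iso (S₂ := ShortComplex.mk (F.cx.d 1 0) (ModuleCat.ofHom F.ε : F.cx.X 0 ⟶ ModuleCat.of R M) F.cx_w) ?_).2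
          ⟨?_, ?_⟩
        · exact ShortComplex.isoMk (Iso.refl _) (Iso.refl _) (Iso.refl _)
            ((Category.id_comp _).trans (Category.comp_id _).symm)
            ((Category.id_comp _).trans ((ChainComplex.toSingle₀Equiv_symm_apply_f_zero
              (C := F.cx) (X := ModuleCat.of R M) _ F.cx_w).symm.trans (Category.comp_id _).symm))
        · rw [ShortComplex.ShortExact.moduleCat_exact_iff_function_exact]
          change Function.Exact (F.cx.d 1 0) F.ε
          rw [show F.cx.d 1 0 = _ from F.cx_d 0]
          exact F.exact0
        · exact (ModuleCat.epi_iff_surjective (X := ModuleCat.of R (F.X 0)) (ModuleCat.ofHom F.ε)).2 F.surj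
      all_goals rfl
    · rw [quasiIsoAt_iff_exactAt']
      · apply cx_exactAt_succ
      · apply ChainComplex.exactAt_succ_single_obj⟩

lemma subsingleton_iff_aux (N : Type u) [AddCommGroup N] [Module R N] (i : ℕ) :
    Subsingleton (((Ext R (ModuleCat.{u} R) (i + 1)).obj
           (Opposite.op (ModuleCat.of R M))).obj (ModuleCat.of R N)) ↔
    Function.Exact (fun φ : F.X i →ₗ[R] N => φ.comp (F.d i))
      (fun φ : F.X (i + 1) →ₗ[R] N => φ.comp (F.d (i + 1))) := by
  rw [← ModuleCat.isZero_iff_subsingleton]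
  rw [(F.res.isoExt (i + 1) (ModuleCat.of R N)).isZero_iff]
  rw [← HomologicalComplex.exactAt_iff_isZero_homology]
  rw [HomologicalComplex.exactAt_iff' _ i (i + 1) (i + 2) (by simp) (by simp)]
  rw [ShortComplex.ShortExact.moduleCat_exact_iff_function_exact]
  change Function.Exact (fun φ : F.cx.X i ⟶ ModuleCat.of R N => F.cx.d (i+1) i ≫ φ)
    (fun φ : F.cx.X (i+1) ⟶ ModuleCat.of R N => F.cx.d (i+1+1) (i+1) ≫ φ) ↔ _
  rw [cx_d, cx_d]
  constructor
  · intro h φ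
    constructor
    · intro hφ
      obtain ⟨ψ, hψ⟩ := (h (ModuleCat.ofHom φ)).1 (ModuleCat.hom_ext hφ)
      exact ⟨ModuleCat.Hom.hom ψ, congrArg ModuleCat.Hom.hom hψ⟩
    · rintro ⟨ψ, hψ⟩
      exact congrArg ModuleCat.Hom.hom ((h (ModuleCat.ofHom φ)).2 ⟨ModuleCat.ofHom ψ, ModuleCat.hom_ext hψ⟩)
  · intro h φ
    constructor
    · intro hφ
      obtain ⟨ψ, hψ⟩ := (h (ModuleCat.Hom.hom φ)).1 (congrArg ModuleCat.Hom.hom hφ)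
      exact ⟨ModuleCat.ofHom ψ, ModuleCat.hom_ext hψ⟩
    · rintro ⟨ψ, hψ⟩
      exact ModuleCat.hom_ext ((h (ModuleCat.Hom.hom φ)).2 ⟨ModuleCat.Hom.hom ψ, congrArg ModuleCat.Hom.hom hψ⟩)

end FRes


section abstractLemmas

variable {R : Type u} [CommRing R]

lemma exact_dualDual {A B C : Type u} [AddCommGroup A] [Module R A] [AddCommGroup B] [Module R B]
    [AddCommGroup C] [Module R C] [Module.IsReflexive R A] [Module.IsReflexive R B]
    [Module.IsReflexive R C] (f : A →ₗ[R] B) (g : B →ₗ[R] C) (h : Function.Exact f g) :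
    Function.Exact f.dualMap.dualMap g.dualMap.dualMap := by
  intro y
  obtain ⟨b, rfl⟩ := (Module.bijective_dual_eval R B).2 y
  constructor
  · intro hy
    have hb : g b = 0 := (Module.bijective_dual_eval R C).1 (by rw [map_zero]; exact hy)
    obtain ⟨a, rfl⟩ := (h b).1 hb
    exact ⟨Module.Dual.eval R A a, rfl⟩
  · rintro ⟨y, hy⟩
    obtain ⟨a, rfl⟩ := (Module.bijective_dual_eval R A).2 y
    have hab : f a = b := (Module.bijective_dual_eval R B).1 hy
    rw [← hab]
    change Module.Dual.eval R C (g (f a)) = 0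
    rw [h.apply_apply_eq_zero, map_zero]

/-- The factorisation of a differential through the cokernel of the previous one. -/
lemma exists_factor {P₁ P₀ N₁ G : Type u} [AddCommGroup P₁] [Module R P₁] [AddCommGroup P₀]
    [Module R P₀] [AddCommGroup N₁] [Module R N₁] [AddCommGroup G] [Module R G]
    (d : P₁ →ₗ[R] P₀) (a : P₀ →ₗ[R] N₁) (f : P₀ →ₗ[R] G) (hf : Function.Surjective f)
    (hk : LinearMap.ker f = LinearMap.range d) (h : Function.Exact d a) :
    ∃ ι : G →ₗ[R] N₁, ι.comp f = a ∧ Function.Injective ι := by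
  have hka : LinearMap.ker f = LinearMap.ker a := by rw [hk, ← LinearMap.exact_iff.1 h]
  let e := f.quotKerEquivOfSurjective hf
  refine ⟨((LinearMap.ker f).liftQ a hka.le).comp e.symm.toLinearMap, ?_, ?_⟩
  · ext x
    have : e.symm (f x) = Submodule.Quotient.mk x := by
      rw [LinearEquiv.symm_apply_eq]; rfl
    simp [this]
  · intro x y hxy
    obtain ⟨x, rfl⟩ := hf x
    obtain ⟨y, rfl⟩ := hf y
    have : ∀ x, e.symm (f x) = Submodule.Quotient.mk x := fun x => by
      rw [LinearEquiv.symm_apply_eq]; rfl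
    simp only [LinearMap.comp_apply, LinearEquiv.coe_coe, this, Submodule.liftQ_apply] at hxy
    have h2 : x - y ∈ LinearMap.ker f := by
      rw [hka, LinearMap.mem_ker, map_sub, hxy, sub_self]
    rw [LinearMap.mem_ker, map_sub, sub_eq_zero] at h2
    exact h2

lemma dual_surj {P₁ P₀ N₁ G : Type u} [AddCommGroup P₁] [Module R P₁] [AddCommGroup P₀]
    [Module R P₀] [AddCommGroup N₁] [Module R N₁] [AddCommGroup G] [Module R G]
    (d : P₁ →ₗ[R] P₀) (a : P₀ →ₗ[R] N₁) (f : P₀ →ₗ[R] G) (hf : Function.Surjective f)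
    (hk : LinearMap.ker f = LinearMap.range d) (ι : G →ₗ[R] N₁) (hι : ι.comp f = a)
    (h : Function.Exact a.dualMap d.dualMap) : Function.Surjective ι.dualMap := by
  intro ψ
  obtain ⟨φ, hφ⟩ := (h (ψ.comp f)).1 (by
    ext x
    have : d x ∈ LinearMap.ker f := hk ▸ LinearMap.mem_range_self d x
    change ψ (f (d x)) = 0
    rw [LinearMap.mem_ker.1 this, map_zero])
  refine ⟨φ, ?_⟩
  ext x
  obtain ⟨x, rfl⟩ := hf x
  have := LinearMap.congr_fun hφ x
  rw [← hι] at this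
  exact this

lemma dual_exact0 {P₀ N₁ N₂ G : Type u} [AddCommGroup P₀]
    [Module R P₀] [AddCommGroup N₁] [Module R N₁] [AddCommGroup G] [Module R G]
    [AddCommGroup N₂] [Module R N₂]
    (a : P₀ →ₗ[R] N₁) (b : N₁ →ₗ[R] N₂) (f : P₀ →ₗ[R] G) (hf : Function.Surjective f)
    (ι : G →ₗ[R] N₁) (hι : ι.comp f = a)
    (h : Function.Exact b.dualMap a.dualMap) : Function.Exact b.dualMap ι.dualMap := by
  intro ψ
  rw [← h ψ, ← hι]
  constructor
  · intro hψ
    ext x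
    exact LinearMap.congr_fun hψ (f x)
  · intro hψ
    ext x
    obtain ⟨x, rfl⟩ := hf x
    exact LinearMap.congr_fun hψ x

lemma eval_bij {P₀ N₁ N₂ G : Type u} [AddCommGroup P₀]
    [Module R P₀] [AddCommGroup N₁] [Module R N₁] [AddCommGroup G] [Module R G]
    [AddCommGroup N₂] [Module R N₂] [Module.IsReflexive R N₁] [Module.IsReflexive R N₂]
    (a : P₀ →ₗ[R] N₁) (b : N₁ →ₗ[R] N₂) (f : P₀ →ₗ[R] G) (hf : Function.Surjective f)
    (ι : G →ₗ[R] N₁) (hι : ι.comp f = a) (hinj : Function.Injective ι)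
    (hab : Function.Exact a b) (hs : Function.Surjective ι.dualMap) :
    Function.Bijective (Module.Dual.eval R G) := by
  have hb : ∀ g, b (ι g) = 0 := fun g => by
    obtain ⟨x, rfl⟩ := hf g
    have := hab.apply_apply_eq_zero x
    rwa [← hι] at this
  constructor
  · intro x y hxy
    apply hinj
    apply (Module.bijective_dual_eval R N₁).1
    exact congrArg ι.dualMap.dualMap hxy
  · intro ξ
    obtain ⟨n, hn⟩ := (Module.bijective_dual_eval R N₁).2 (ι.dualMap.dualMap ξ)
    have hbn : b n = 0 := by
      apply (Module.bijective_dual_eval R N₂).1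
      rw [map_zero]
      change b.dualMap.dualMap (Module.Dual.eval R N₁ n) = 0
      rw [hn]
      ext φ
      change ξ (ι.dualMap (b.dualMap φ)) = 0
      rw [show ι.dualMap (b.dualMap φ) = 0 from by
        ext g; change φ (b (ι g)) = 0; rw [hb, map_zero], map_zero]
    obtain ⟨x, rfl⟩ := (hab n).1 hbn
    refine ⟨f x, ?_⟩
    ext ψ
    obtain ⟨φ, rfl⟩ := hs ψ
    have := LinearMap.congr_fun hn φ
    rw [← hι] at this
    exact this

end abstractLemmas

section forward

variable {R : Type u} [CommRing R] (L : ModComplex R) (hL : L.TotallyAcyclic)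
  {G : Type u} [AddCommGroup G] [Module R G]

lemma ModComplex.TotallyAcyclic.dualExact {L : ModComplex R} (hL : L.TotallyAcyclic) (i : ℤ) :
    Function.Exact (L.d i).dualMap (L.d (i + 1)).dualMap := hL.2.2 i

/-- The nonnegative part. -/
def FRes.ofPos (f : L.X 0 →ₗ[R] G) (hf : Function.Surjective f)
    (hk : LinearMap.ker f = LinearMap.range (L.d 0)) : FRes R G where
  X n := L.X (Int.ofNat n)
  fin n := (hL.2.1 _).1
  proj n := (hL.2.1 _).2
  d n := L.d (Int.ofNat n)
  ε := f
  surj := hf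
  exact0 := LinearMap.exact_iff.2 hk
  exact n := hL.1 (Int.ofNat n)

/-- The dual of the negative part. -/
def FRes.ofNeg (ι : G →ₗ[R] L.X (Int.negSucc 0)) (hs : Function.Surjective ι.dualMap)
    (hι : Function.Exact (L.d (Int.negSucc 1)).dualMap ι.dualMap) :
    FRes R (Module.Dual R G) where
  X n := Module.Dual R (L.X (Int.negSucc n))
  fin n := by
    have := (hL.2.1 (Int.negSucc n)).1
    have := (hL.2.1 (Int.negSucc n)).2
    infer_instance
  proj n := by
    have := (hL.2.1 (Int.negSucc n)).1
    have := (hL.2.1 (Int.negSucc n)).2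
    infer_instance
  d n := (L.d (Int.negSucc (n + 1))).dualMap
  ε := ι.dualMap
  surj := hs
  exact0 := hι
  exact n := hL.2.2 (Int.negSucc (n + 2))

lemma forward (hG : IsTotallyReflexive R G) :
    Function.Bijective (Module.Dual.eval R G) ∧
       (∀ i : ℕ, 1 ≤ i →
         Subsingleton (((Ext R (ModuleCat.{u} R) i).obj
           (Opposite.op (ModuleCat.of R G))).obj (ModuleCat.of R R))) ∧
       (∀ i : ℕ, 1 ≤ i →
         Subsingleton (((Ext R (ModuleCat.{u} R) i).obj
           (Opposite.op (ModuleCat.of R (Module.Dual R G)))).obj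
           (ModuleCat.of R R))) := by
  obtain ⟨L, hL, f, hf, hk⟩ := hG
  have hr : ∀ i, Module.IsReflexive R (L.X i) := fun i => by
    have := (hL.2.1 i).1
    have := (hL.2.1 i).2
    infer_instance
  obtain ⟨ι, hι, hinj⟩ := exists_factor (N₁ := L.X (Int.negSucc 0)) (L.d 0)
    (L.d (Int.negSucc 0)) f hf hk (hL.1 (Int.negSucc 0))
  have hs : Function.Surjective ι.dualMap := dual_surj (L.d 0) (L.d (Int.negSucc 0)) f hf hk ι hι
    (hL.dualExact (Int.negSucc 0))
  have he : Function.Exact (L.d (Int.negSucc 1)).dualMap ι.dualMap :=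
    dual_exact0 (L.d (Int.negSucc 0)) (L.d (Int.negSucc 1)) f hf ι hι
      (hL.dualExact (Int.negSucc 1))
  refine ⟨eval_bij (L.d (Int.negSucc 0)) (L.d (Int.negSucc 1)) f hf ι hι hinj
    (hL.1 (Int.negSucc 1)) hs, ?_, ?_⟩
  · rintro (_ | i) hi
    · omega
    · exact ((FRes.ofPos L hL f hf hk).subsingleton_iff_aux R i).2 (hL.2.2 (Int.ofNat i))
  · rintro (_ | i) hi
    · omega
    · refine ((FRes.ofNeg L hL ι hs he).subsingleton_iff_aux R i).2 ?_
      exact exact_dualDual (L.d (Int.negSucc (i + 1))) (L.d (Int.negSucc (i + 2)))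
        (hL.1 (Int.negSucc (i + 2)))

end forward

section existence

variable (R : Type u) [CommRing R]

/-- Bundled finitely generated modules. -/
structure FMod : Type (u + 1) where
  M : Type u
  [addCommGroup : AddCommGroup M]
  [module : Module R M]
  fin : Module.Finite R M

attribute [instance] FMod.addCommGroup FMod.module FMod.fin

variable {R}

noncomputable def FMod.rk (A : FMod R) : ℕ := (Module.Finite.exists_fin' R A.M).choose

noncomputable def FMod.cov (A : FMod R) : (Fin A.rk → R) →ₗ[R] A.M :=
  (Module.Finite.exists_fin' R A.M).choose_spec.choose

lemma FMod.cov_surj (A : FMod R) : Function.Surjective A.cov :=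
  (Module.Finite.exists_fin' R A.M).choose_spec.choose_spec

variable [IsNoetherianRing R]

noncomputable def FMod.next (A : FMod R) : FMod R where
  M := LinearMap.ker A.cov
  fin := inferInstance

noncomputable def FMod.syz (A : FMod R) : ℕ → FMod R
  | 0 => A
  | n + 1 => (A.syz n).next

noncomputable def FMod.res (A : FMod R) : FRes R A.M where
  X n := Fin (A.syz n).rk → R
  fin n := inferInstance
  proj n := inferInstance
  d n := (LinearMap.ker (A.syz n).cov).subtype.comp (A.syz (n + 1)).cov
  ε := A.cov
  surj := A.cov_surj
  exact0 := by
    intro y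
    constructor
    · intro hy
      obtain ⟨x, hx⟩ := (A.syz 1).cov_surj ⟨y, hy⟩
      exact ⟨x, congrArg Subtype.val hx⟩
    · rintro ⟨x, rfl⟩
      exact Subtype.property ((A.syz 1).cov x)
  exact n := by
    intro y
    constructor
    · intro hy
      have hy' : (A.syz (n + 1)).cov y = 0 := Subtype.ext hy
      obtain ⟨x, hx⟩ := (A.syz (n + 2)).cov_surj ⟨y, hy'⟩
      exact ⟨x, congrArg Subtype.val hx⟩
    · rintro ⟨x, rfl⟩
      have : (A.syz (n + 1)).cov ((A.syz (n+2)).cov x).1 = 0 :=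
        Subtype.property ((A.syz (n+2)).cov x)
      exact congrArg Subtype.val this

lemma exists_fres (M : Type u) [AddCommGroup M] [Module R M] [h : Module.Finite R M] :
    Nonempty (FRes R M) := ⟨FMod.res ⟨M, h⟩⟩

end existence

section splice

variable {R : Type u} [CommRing R] {G : Type u} [AddCommGroup G] [Module R G]
  (P : FRes R G) (Q : FRes R (Module.Dual R G))

def spliceX : ℤ → Type u
  | Int.ofNat n => P.X n
  | Int.negSucc n => Module.Dual R (Q.X n)

instance : ∀ i, AddCommGroup (spliceX P Q i)
  | Int.ofNat n => inferInstanceAs (AddCommGroup (P.X n))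
  | Int.negSucc n => inferInstanceAs (AddCommGroup (Module.Dual R (Q.X n)))

instance : ∀ i, Module R (spliceX P Q i)
  | Int.ofNat n => inferInstanceAs (Module R (P.X n))
  | Int.negSucc n => inferInstanceAs (Module R (Module.Dual R (Q.X n)))

def spliceMid : P.X 0 →ₗ[R] Module.Dual R (Q.X 0) :=
  Q.ε.dualMap.comp ((Module.Dual.eval R G).comp P.ε)

def spliceD : ∀ i : ℤ, spliceX P Q (i + 1) →ₗ[R] spliceX P Q i
  | Int.ofNat n => P.d n
  | Int.negSucc 0 => spliceMid P Q
  | Int.negSucc (n + 1) => (Q.d n).dualMap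

lemma mid_exact_left (h : Function.Injective (Module.Dual.eval R G)) :
    Function.Exact (P.d 0) (spliceMid P Q) := by
  intro y
  rw [← P.exact0 y]
  constructor
  · intro hy
    apply h
    rw [map_zero]
    exact (LinearMap.dualMap_injective_of_surjective Q.surj) (hy.trans (map_zero _).symm)
  · intro hy
    change Q.ε.dualMap (Module.Dual.eval R G (P.ε y)) = 0
    rw [hy, map_zero, map_zero]

lemma mid_exact_right (h : Function.Surjective (Module.Dual.eval R G)) :
    Function.Exact (spliceMid P Q) (Q.d 0).dualMap := by
  intro φ
  constructor
  · intro hφ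
    obtain ⟨ι, hι⟩ : ∃ ξ : Module.Dual R (Module.Dual R G), ξ.comp Q.ε = φ := by
      have hk : LinearMap.ker Q.ε ≤ LinearMap.ker φ := by
        rw [LinearMap.exact_iff.1 Q.exact0]
        rintro _ ⟨x, rfl⟩
        exact LinearMap.congr_fun hφ x
      refine ⟨((LinearMap.ker Q.ε).liftQ φ hk).comp
        (Q.ε.quotKerEquivOfSurjective Q.surj).symm.toLinearMap, ?_⟩
      ext x
      have : (Q.ε.quotKerEquivOfSurjective Q.surj).symm (Q.ε x) = Submodule.Quotient.mk x := by
        rw [LinearEquiv.symm_apply_eq]; rfl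
      simp [this]
    obtain ⟨g, rfl⟩ := h ι
    obtain ⟨x, rfl⟩ := P.surj g
    exact ⟨x, hι⟩
  · rintro ⟨x, rfl⟩
    ext q
    change Q.ε (Q.d 0 q) (P.ε x) = 0
    rw [Q.exact0.apply_apply_eq_zero]
    rfl

lemma mid_dual_eval (q : Q.X 0) :
    (spliceMid P Q).dualMap (Module.Dual.eval R _ q) = (Q.ε q).comp P.ε := rfl

lemma mid_dual_exact_left : Function.Exact (spliceMid P Q).dualMap (P.d 0).dualMap := by
  intro φ
  constructor
  · intro hφ
    obtain ⟨ψ, hψ⟩ : ∃ ξ : Module.Dual R G, ξ.comp P.ε = φ := by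
      have hk : LinearMap.ker P.ε ≤ LinearMap.ker φ := by
        rw [LinearMap.exact_iff.1 P.exact0]
        rintro _ ⟨x, rfl⟩
        exact LinearMap.congr_fun hφ x
      refine ⟨((LinearMap.ker P.ε).liftQ φ hk).comp
        (P.ε.quotKerEquivOfSurjective P.surj).symm.toLinearMap, ?_⟩
      ext x
      have : (P.ε.quotKerEquivOfSurjective P.surj).symm (P.ε x) = Submodule.Quotient.mk x := by
        rw [LinearEquiv.symm_apply_eq]; rfl
      simp [this]
    obtain ⟨q, rfl⟩ := Q.surj ψ
    exact ⟨Module.Dual.eval R _ q, hψ⟩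
  · rintro ⟨ξ, rfl⟩
    ext x
    change ξ (Q.ε.dualMap (Module.Dual.eval R G (P.ε (P.d 0 x)))) = 0
    rw [P.exact0.apply_apply_eq_zero, map_zero, map_zero, map_zero]

lemma mid_dual_exact_right :
    Function.Exact (Q.d 0).dualMap.dualMap (spliceMid P Q).dualMap := by
  intro ξ
  obtain ⟨q, rfl⟩ := (Module.bijective_dual_eval R (Q.X 0)).2 ξ
  rw [mid_dual_eval]
  constructor
  · intro h
    have : Q.ε q = 0 := by
      ext g
      obtain ⟨x, rfl⟩ := P.surj g
      exact LinearMap.congr_fun h x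
    obtain ⟨y, rfl⟩ := (Q.exact0 q).1 this
    exact ⟨Module.Dual.eval R _ y, rfl⟩
  · rintro ⟨y, hy⟩
    obtain ⟨y, rfl⟩ := (Module.bijective_dual_eval R (Q.X 1)).2 y
    have : Q.d 0 y = q := (Module.bijective_dual_eval R (Q.X 0)).1 hy
    rw [← this, Q.exact0.apply_apply_eq_zero]
    rfl

lemma splice_exact (h : Function.Bijective (Module.Dual.eval R G))
    (hQ : ∀ i, Function.Exact (Q.d i).dualMap (Q.d (i + 1)).dualMap) :
    ∀ i : ℤ, Function.Exact (spliceD P Q (i + 1)) (spliceD P Q i)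
  | Int.ofNat n => P.exact n
  | Int.negSucc 0 => mid_exact_left P Q h.1
  | Int.negSucc 1 => mid_exact_right P Q h.2
  | Int.negSucc (n + 2) => hQ n

def splice (h : Function.Bijective (Module.Dual.eval R G))
    (hQ : ∀ i, Function.Exact (Q.d i).dualMap (Q.d (i + 1)).dualMap) : ModComplex R where
  X := spliceX P Q
  d := spliceD P Q
  dd i := LinearMap.ext fun x => (splice_exact P Q h hQ i).apply_apply_eq_zero x

lemma backward (h : Function.Bijective (Module.Dual.eval R G))
    (hP : ∀ i, Function.Exact (P.d i).dualMap (P.d (i + 1)).dualMap)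
    (hQ : ∀ i, Function.Exact (Q.d i).dualMap (Q.d (i + 1)).dualMap) :
    IsTotallyReflexive R G := by
  refine ⟨splice P Q h hQ, ⟨splice_exact P Q h hQ, ?_, ?_⟩, P.ε, P.surj,
    LinearMap.exact_iff.1 P.exact0⟩
  · rintro (n | n)
    · exact ⟨P.fin n, P.proj n⟩
    · exact ⟨inferInstanceAs (Module.Finite R (Module.Dual R (Q.X n))),
        inferInstanceAs (Module.Projective R (Module.Dual R (Q.X n)))⟩
  · rintro (n | _ | _ | n)
    · exact hP n
    · exact mid_dual_exact_left P Q
    · exact mid_dual_exact_right P Q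
    · exact exact_dualDual _ _ (Q.exact n)

end splice

/-- Over a Noetherian ring, a finitely generated module `G` is totally
reflexive iff it is reflexive and `Ext^i(G,R) = 0 = Ext^i(Hom(G,R),R)`
for all `i ≥ 1`. -/
theorem totallyReflexive_iff_reflexive_ext_vanishing
    {R : Type u} [CommRing R] [IsNoetherianRing R]
    (G : Type u) [AddCommGroup G] [Module R G] [Module.Finite R G] :
    IsTotallyReflexive R G ↔
      (Function.Bijective (Module.Dual.eval R G) ∧
       (∀ i : ℕ, 1 ≤ i →
         Subsingleton (((Ext R (ModuleCat.{u} R) i).obj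
           (Opposite.op (ModuleCat.of R G))).obj (ModuleCat.of R R))) ∧
       (∀ i : ℕ, 1 ≤ i →
         Subsingleton (((Ext R (ModuleCat.{u} R) i).obj
           (Opposite.op (ModuleCat.of R (Module.Dual R G)))).obj
           (ModuleCat.of R R)))) := by
  constructor
  · exact forward
  · rintro ⟨h, h1, h2⟩
    obtain ⟨P⟩ := exists_fres (R := R) G
    obtain ⟨Q⟩ := exists_fres (R := R) (Module.Dual R G)
    exact backward P Q h
      (fun i => (P.subsingleton_iff_aux R i).1 (h1 (i + 1) (by omega)))
      (fun i => (Q.subsingleton_iff_aux R i).1 (h2 (i + 1) (by omega)))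
end

section
/- Let R be a commutative ring, M an R-module, and E an injective R-module. If M is Gorenstein flat, then Hom_R(M, E) is Gorenstein injective. -/
universe u

open TensorProduct

section HomHelpers

variable {R : Type u} [CommRing R]

theorem exact_hom_aux {A B C E : Type u} [AddCommGroup A] [Module R A] [AddCommGroup B]
    [Module R B] [AddCommGroup C] [Module R C] [AddCommGroup E] [Module R E]
    (hE : Module.Injective R E) (f : A →ₗ[R] B) (g : B →ₗ[R] C) (h : Function.Exact f g)
    (φ : B →ₗ[R] E) (hφ : φ.comp f = 0) : ∃ ψ : C →ₗ[R] E, ψ.comp g = φ := by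
  have hle : LinearMap.ker g ≤ LinearMap.ker φ := by
    intro x hx
    obtain ⟨a, rfl⟩ := (h x).1 hx
    exact LinearMap.congr_fun hφ a
  have hinj : Function.Injective ((LinearMap.ker g).liftQ g le_rfl) := by
    rw [← LinearMap.ker_eq_bot]
    exact Submodule.ker_liftQ_eq_bot _ _ _ le_rfl
  obtain ⟨ψ, hψ⟩ := hE.out ((LinearMap.ker g).liftQ g le_rfl) hinj ((LinearMap.ker g).liftQ φ hle)
  refine ⟨ψ, LinearMap.ext fun x => ?_⟩
  simpa using hψ (Submodule.Quotient.mk x)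

theorem injective_hom_aux (F E : Type u) [AddCommGroup F] [Module R F] [AddCommGroup E]
    [Module R E] (hE : Module.Injective R E) (hF : Module.Flat R F) :
    Module.Injective R (F →ₗ[R] E) := by
  refine ⟨fun X Y _ _ _ _ f hf g => ?_⟩
  obtain ⟨ψ, hψ⟩ := hE.out (LinearMap.rTensor F f)
    (Module.Flat.rTensor_preserves_injective_linearMap f hf) (TensorProduct.lift g)
  refine ⟨TensorProduct.curry ψ, fun x => LinearMap.ext fun y => ?_⟩
  simpa using hψ (x ⊗ₜ y)

/-- The differential of a complex between indices that are only propositionally consecutive. -/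
def ModComplex.del (L : ModComplex R) (i j : ℤ) (h : j + 1 = i) : L.X i →ₗ[R] L.X j :=
  h ▸ L.d j

theorem ModComplex.del_comp (L : ModComplex R) (i j k : ℤ) (h : j + 1 = i) (h' : k + 1 = j) :
    (L.del j k h').comp (L.del i j h) = 0 := by
  subst h' h
  exact L.dd k

theorem ModComplex.del_exact (L : ModComplex R) (hL : L.Acyclic) (i j k : ℤ) (h : j + 1 = i)
    (h' : k + 1 = j) : Function.Exact (L.del i j h) (L.del j k h') := by
  subst h' h
  exact hL k

theorem ModComplex.del_tensor (L : ModComplex R) (N : Type u) [AddCommGroup N] [Module R N]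
    (hL : L.TensorAcyclic N) (i j k : ℤ) (h : j + 1 = i) (h' : k + 1 = j) :
    Function.Exact (LinearMap.lTensor N (L.del i j h)) (LinearMap.lTensor N (L.del j k h')) := by
  subst h' h
  exact hL k

/-- The complex `Hom_R(L, E)`, reindexed homologically. -/
def ModComplex.homC (L : ModComplex R) (E : Type u) [AddCommGroup E] [Module R E] :
    ModComplex R where
  X i := L.X (1 - i) →ₗ[R] E
  d i := (L.del (1 - i) (1 - (i + 1)) (by ring)).lcomp R E
  dd i := by
    ext φ x
    have := LinearMap.congr_fun
      (L.del_comp (1 - i) (1 - (i + 1)) (1 - (i + 1 + 1)) (by ring) (by ring)) x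
    simp only [LinearMap.comp_apply, LinearMap.zero_apply] at this
    simp [this]

end HomHelpers

/-- If `M` is Gorenstein flat and `E` is injective, then `Hom_R(M, E)` is
Gorenstein injective. -/
theorem gorensteinInjective_hom_of_gorensteinFlat {R : Type u} [CommRing R]
    (M E : Type u) [AddCommGroup M] [Module R M] [AddCommGroup E] [Module R E]
    (hE : Module.Injective R E) (hM : IsGorensteinFlat R M) :
    IsGorensteinInjective R (M →ₗ[R] E) := by
  obtain ⟨L, hac, hflat, htens, f, hf, hker⟩ := hM
  refine ⟨L.homC E, fun i => ?_, fun i => injective_hom_aux _ _ hE (hflat _), ?_, ?_⟩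
  · intro φ
    have hex := L.del_exact hac (1 - i) (1 - (i + 1)) (1 - (i + 1 + 1)) (by ring) (by ring)
    constructor
    · intro h
      exact exact_hom_aux hE _ _ hex φ h
    · rintro ⟨ψ, rfl⟩
      exact LinearMap.congr_fun ((L.homC E).dd i) ψ
  · intro N _ _ hN i φ
    have hex := L.del_tensor N (htens N hN) (1 - i) (1 - (i + 1)) (1 - (i + 1 + 1))
      (by ring) (by ring)
    constructor
    · intro h
      obtain ⟨ψ, hψ⟩ := exact_hom_aux hE _ _ hex (TensorProduct.lift φ) (by
        refine TensorProduct.ext' fun n x => ?_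
        exact LinearMap.congr_fun (LinearMap.congr_fun h n) x)
      refine ⟨TensorProduct.curry ψ, LinearMap.ext fun n => LinearMap.ext fun x => ?_⟩
      exact LinearMap.congr_fun hψ (n ⊗ₜ x)
    · rintro ⟨ψ, rfl⟩
      refine LinearMap.ext fun n => ?_
      exact LinearMap.congr_fun ((L.homC E).dd i) (ψ n)
  · have hex : Function.Exact (L.d 0) f := LinearMap.exact_iff.2 hker
    refine ⟨f.lcomp R E, ?_, ?_⟩
    · intro a b hab
      refine LinearMap.ext fun m => ?_
      obtain ⟨x, rfl⟩ := hf m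
      exact LinearMap.congr_fun hab x
    · ext φ
      constructor
      · rintro ⟨ψ, rfl⟩
        refine LinearMap.mem_ker.2 (LinearMap.ext fun x => ?_)
        have h0 : f (L.d 0 x) = 0 := hex.apply_apply_eq_zero x
        exact (congrArg ψ h0).trans (map_zero ψ)
      · intro h
        exact exact_hom_aux hE _ _ hex φ h
end

section
/- Let R be a commutative ring. If M is an R-module with a Gorenstein projective resolution ⋯ → A_1 → A_0 → M → 0 such that, for some n, Ext^i_R(M, Q) = 0 for all i > n and all projective R-modules Q, and M has finite Gorenstein projective dimension, then the cokernel Coker(A_{n+1} → A_n) is Gorenstein projective. -/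
universe u

open TensorProduct

open CategoryTheory

open CategoryTheory

namespace GPaux

variable {R : Type u} [CommRing R]

/-- Short exact sequences, unbundled. -/
structure SES {A B C : Type u} [AddCommGroup A] [Module R A] [AddCommGroup B] [Module R B]
    [AddCommGroup C] [Module R C] (f : A →ₗ[R] B) (g : B →ₗ[R] C) : Prop where
  inj : Function.Injective f
  ex : Function.Exact f g
  surj : Function.Surjective g

/-- Vanishing of `Ext^k(M,N)`. -/
def EV (R : Type u) [CommRing R] (k : ℕ) (M N : Type u) [AddCommGroup M] [Module R M]
    [AddCommGroup N] [Module R N] : Prop :=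
  ∀ e : Abelian.Ext (ModuleCat.of R M) (ModuleCat.of R N) k, e = 0

/-- Finite projective dimension. -/
def FPD (R : Type u) [CommRing R] (M : Type u) [AddCommGroup M] [Module R M] : Prop :=
  ∃ d, HasProjectiveDimensionLT (ModuleCat.of R M) d

variable {A B C : Type u} [AddCommGroup A] [Module R A] [AddCommGroup B] [Module R B]
    [AddCommGroup C] [Module R C] {f : A →ₗ[R] B} {g : B →ₗ[R] C}

/-- The bundled version. -/
abbrev SES.sc (h : SES f g) : ShortComplex (ModuleCat.{u} R) :=
  ShortComplex.mk (ModuleCat.ofHom f) (ModuleCat.ofHom g) (by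
    ext x
    exact h.ex.apply_apply_eq_zero x)

lemma SES.shortExact (h : SES f g) : h.sc.ShortExact where
  exact := by
    rw [ShortComplex.ShortExact.moduleCat_exact_iff_function_exact]
    exact h.ex
  mono_f := (ModuleCat.mono_iff_injective _).2 h.inj
  epi_g := (ModuleCat.epi_iff_surjective _).2 h.surj

variable {N : Type u} [AddCommGroup N] [Module R N]

lemma SES.ev_mid (h : SES f g) {k : ℕ} (h1 : EV R k A N) (h3 : EV R k C N) : EV R k B N := by
  intro e
  obtain ⟨x, rfl⟩ := Abelian.Ext.contravariant_sequence_exact₂ h.shortExact (ModuleCat.of R N) e (h1 _)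
  rw [h3 x, Abelian.Ext.comp_zero]

lemma SES.ev_left (h : SES f g) {k : ℕ} (h2 : EV R k B N) (h3 : EV R (k+1) C N) : EV R k A N := by
  intro e
  obtain ⟨x, rfl⟩ := Abelian.Ext.contravariant_sequence_exact₁ h.shortExact (ModuleCat.of R N) e
    (add_comm 1 k) (h3 _)
  rw [h2 x, Abelian.Ext.comp_zero]

lemma SES.ev_right (h : SES f g) {k : ℕ} (h1 : EV R k A N) (h2 : EV R (k+1) B N) :
    EV R (k+1) C N := by
  intro e
  obtain ⟨x, rfl⟩ := Abelian.Ext.contravariant_sequence_exact₃ h.shortExact (ModuleCat.of R N) e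
    (h2 _) (add_comm 1 k)
  rw [h1 x, Abelian.Ext.comp_zero]

lemma SES.ev_right_one (h : SES f g) (h1 : ∀ φ : A →ₗ[R] N, ∃ ψ : B →ₗ[R] N, ψ ∘ₗ f = φ)
    (h2 : EV R 1 B N) : EV R 1 C N := by
  intro e
  obtain ⟨x, rfl⟩ := Abelian.Ext.contravariant_sequence_exact₃ h.shortExact (ModuleCat.of R N) e
    (h2 _) (add_comm 1 0)
  obtain ⟨x, rfl⟩ := Abelian.Ext.addEquiv₀.symm.surjective x
  obtain ⟨ψ, hψ⟩ := h1 x.hom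
  have : x = h.sc.f ≫ ModuleCat.ofHom ψ := by
    ext a
    exact (LinearMap.congr_fun hψ a).symm
  rw [this, Abelian.Ext.addEquiv₀_symm_apply, ← Abelian.Ext.mk₀_comp_mk₀,
    ShortComplex.ShortExact.extClass_comp_assoc]

lemma SES.extend (h : SES f g) (h3 : EV R 1 C N) (φ : A →ₗ[R] N) :
    ∃ ψ : B →ₗ[R] N, ψ ∘ₗ f = φ := by
  obtain ⟨x, hx⟩ := Abelian.Ext.contravariant_sequence_exact₁ h.shortExact (ModuleCat.of R N)
    (Abelian.Ext.mk₀ (ModuleCat.ofHom φ)) (add_comm 1 0) (h3 _)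
  obtain ⟨x, rfl⟩ := Abelian.Ext.addEquiv₀.symm.surjective x
  refine ⟨x.hom, ?_⟩
  rw [Abelian.Ext.addEquiv₀_symm_apply, Abelian.Ext.mk₀_comp_mk₀] at hx
  have := (Abelian.Ext.mk₀_bijective _ _).1 hx
  exact congrArg ModuleCat.Hom.hom this

lemma SES.ev_co (h : SES f g) {k : ℕ} (h2 : EV R k N B) (h1 : EV R (k+1) N A) : EV R k N C := by
  intro e
  obtain ⟨x, rfl⟩ := Abelian.Ext.covariant_sequence_exact₃ (ModuleCat.of R N) h.shortExact e
    rfl (h1 _)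
  rw [h2 x, Abelian.Ext.zero_comp]

lemma ev_of_projective (hA : Module.Projective R A) (k : ℕ) : EV R (k+1) A N := by
  intro e
  have : Projective (ModuleCat.of R A) := (IsProjective.iff_projective A).1 hA
  exact Abelian.Ext.eq_zero_of_projective e

lemma SES.fpd_right (h : SES f g) (h1 : FPD R A) (h2 : Module.Projective R B) : FPD R C := by
  obtain ⟨d, hd⟩ := h1
  have : Projective (ModuleCat.of R B) := (IsProjective.iff_projective B).1 h2
  have h' : HasProjectiveDimensionLT (ModuleCat.of R B) (d+1) :=
    hasProjectiveDimensionLT_of_ge _ 1 _ (by omega)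
  exact ⟨d+1, h.shortExact.hasProjectiveDimensionLT_X₃ d hd h'⟩

lemma SES.fpd_left (h : SES f g) (h1 : FPD R C) (h2 : Module.Projective R B) : FPD R A := by
  obtain ⟨d, hd⟩ := h1
  have : Projective (ModuleCat.of R B) := (IsProjective.iff_projective B).1 h2
  have h' : HasProjectiveDimensionLT (ModuleCat.of R B) (d+1) :=
    hasProjectiveDimensionLT_of_ge _ 1 _ (by omega)
  have h'' : HasProjectiveDimensionLT (ModuleCat.of R C) (d+2) :=
    hasProjectiveDimensionLT_of_ge _ d _ (by omega)
  exact ⟨d+1, h.shortExact.hasProjectiveDimensionLT_X₁ (d+1) h' h''⟩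

lemma fpd_of_projective (hA : Module.Projective R A) : FPD R A := by
  have : Projective (ModuleCat.of R A) := (IsProjective.iff_projective A).1 hA
  exact ⟨1, inferInstance⟩

lemma projective_of_ev (h : ∀ (N : Type u) [AddCommGroup N] [Module R N], EV R 1 A N) :
    Module.Projective R A := by
  rw [IsProjective.iff_projective, projective_iff_subsingleton_ext_one]
  intro Y
  exact ⟨fun a b => (h Y a).trans (h Y b).symm⟩

lemma fpd_iff {d : ℕ} : HasProjectiveDimensionLT (ModuleCat.of R A) d ↔
    ∀ k, d ≤ k → ∀ (N : Type u) [AddCommGroup N] [Module R N], EV R k A N := by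
  rw [hasProjectiveDimensionLT_iff]
  exact ⟨fun h k hk N _ _ e => h k hk e, fun h k hk Y e => h k hk Y e⟩

/-- the canonical projective cover -/
lemma exists_cover (A : Type u) [AddCommGroup A] [Module R A] :
    ∃ (P : ModuleCat.{u} R) (g : P →ₗ[R] A), Module.Projective R P ∧ Function.Surjective g :=
  ⟨ModuleCat.of R (A →₀ R), Finsupp.linearCombination R id,
    (inferInstance : Module.Projective R (A →₀ R)),
    fun a => ⟨Finsupp.single a 1, by simp⟩⟩

lemma ses_ker {g : B →ₗ[R] C} (hg : Function.Surjective g) :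
    SES (LinearMap.ker g).subtype g :=
  ⟨Subtype.val_injective, fun x => by simp, hg⟩

lemma ses_quot {f : A →ₗ[R] B} (hf : Function.Injective f) :
    SES f (LinearMap.range f).mkQ :=
  ⟨hf, fun x => by simp, Submodule.mkQ_surjective _⟩

lemma ev_of_ext {k : ℕ} 
    (h : Subsingleton (((Ext R (ModuleCat.{u} R) (k+1)).obj
          (Opposite.op (ModuleCat.of R A))).obj (ModuleCat.of R N))) : EV R (k+1) A N := by
  intro e
  let P := projectiveResolution (ModuleCat.of R A)
  obtain ⟨φ, hφ, rfl⟩ := P.extMk_surjective e (k+2) rfl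
  rw [P.extMk_eq_zero_iff _ _ _ _ k rfl]
  have hz : Limits.IsZero ((P.complex.linearYonedaObj R (ModuleCat.of R N)).homology (k+1)) :=
    (ModuleCat.isZero_of_subsingleton _).of_iso (P.isoExt (k+1) (ModuleCat.of R N)).symm
  rw [← HomologicalComplex.exactAt_iff_isZero_homology, HomologicalComplex.exactAt_iff' _ k (k+1) (k+2)
    (by simp) (by simp), ShortComplex.moduleCat_exact_iff] at hz
  obtain ⟨ψ, hψ⟩ := hz φ hφ
  exact ⟨ψ, hψ⟩

lemma SES.fpd_mid (h : SES f g) (h1 : FPD R A) (h2 : FPD R C) : FPD R B := by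
  obtain ⟨d, hd⟩ := h1
  obtain ⟨e, he⟩ := h2
  have h' : HasProjectiveDimensionLT (ModuleCat.of R A) (d+e) :=
    hasProjectiveDimensionLT_of_ge _ d _ (by omega)
  have h'' : HasProjectiveDimensionLT (ModuleCat.of R C) (d+e) :=
    hasProjectiveDimensionLT_of_ge _ e _ (by omega)
  exact ⟨d+e, h.shortExact.hasProjectiveDimensionLT_X₂ (d+e) h' h''⟩

lemma ses_prod (A B : Type u) [AddCommGroup A] [Module R A] [AddCommGroup B] [Module R B] :
    SES (LinearMap.inl R A B) (LinearMap.snd R A B) :=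
  ⟨LinearMap.inl_injective, Function.Exact.inl_snd, LinearMap.snd_surjective⟩

lemma factor {p : B →ₗ[R] C} (hp : Function.Surjective p) (φ : B →ₗ[R] N)
    (h : ∀ x, p x = 0 → φ x = 0) : ∃ ψ : C →ₗ[R] N, ∀ x, ψ (p x) = φ x := by
  have hk : LinearMap.ker p ≤ LinearMap.ker φ := fun x hx => h x hx
  refine ⟨(LinearMap.ker p).liftQ φ hk ∘ₗ (p.quotKerEquivOfSurjective hp).symm.toLinearMap, ?_⟩
  intro x
  have : (p.quotKerEquivOfSurjective hp).symm (p x) = (LinearMap.ker p).mkQ x := by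
    rw [LinearEquiv.symm_apply_eq]; rfl
  simp [this]

/-- horseshoe -/
lemma horseshoe {P A' P' C' : Type u} [AddCommGroup P] [Module R P] [AddCommGroup A'] [Module R A']
    [AddCommGroup P'] [Module R P'] [AddCommGroup C'] [Module R C']
    {i : A →ₗ[R] P} {p : P →ₗ[R] A'} {j : C →ₗ[R] P'} {q : P' →ₗ[R] C'}
    (h : SES f g) (hi : SES i p) (hj : SES j q) (ψ : B →ₗ[R] P) (hψ : ψ ∘ₗ f = i) :
    ∃ (D : ModuleCat.{u} R) (t : B →ₗ[R] P × P') (s : P × P' →ₗ[R] D) (a : A' →ₗ[R] D)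
      (c : D →ₗ[R] C'), SES t s ∧ SES a c := by
  have hψ' : ∀ a, ψ (f a) = i a := fun a => LinearMap.congr_fun hψ a
  let t : B →ₗ[R] P × P' := ψ.prod (j ∘ₗ g)
  have ht : ∀ b, t b = (ψ b, j (g b)) := fun b => rfl
  have tinj : Function.Injective t := by
    rw [injective_iff_map_eq_zero]
    intro b hb
    rw [ht, Prod.mk_eq_zero] at hb
    have hg : g b = 0 := hj.inj (by rw [hb.2, map_zero])
    obtain ⟨a, rfl⟩ := (h.ex b).1 hg
    have := hb.1
    rw [hψ'] at this
    rw [hi.inj (this.trans (map_zero i).symm), map_zero]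
  have hs := ses_quot tinj
  obtain ⟨a, ha⟩ := factor hi.surj ((LinearMap.range t).mkQ ∘ₗ LinearMap.inl R P P') (by
    intro x hx
    obtain ⟨y, rfl⟩ := (hi.ex x).1 hx
    refine (hs.ex _).2 ⟨f y, ?_⟩
    simp [ht, hψ', h.ex.apply_apply_eq_zero])
  obtain ⟨c, hc⟩ := factor hs.surj (q ∘ₗ LinearMap.snd R P P') (by
    intro x hx
    obtain ⟨y, rfl⟩ := (hs.ex x).1 hx
    simp [ht, hj.ex.apply_apply_eq_zero])
  refine ⟨ModuleCat.of R ((P × P') ⧸ LinearMap.range t), t, (LinearMap.range t).mkQ, a, c, hs,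
    ?_, ?_, ?_⟩
  · rw [injective_iff_map_eq_zero]
    intro x hx
    obtain ⟨x, rfl⟩ := hi.surj x
    rw [ha] at hx
    obtain ⟨b, hb⟩ := (hs.ex _).1 hx
    simp only [ht, LinearMap.inl_apply, Prod.mk.injEq] at hb
    have hg : g b = 0 := hj.inj (by rw [hb.2, map_zero])
    obtain ⟨a', rfl⟩ := (h.ex b).1 hg
    rw [← hb.1, hψ', hi.ex.apply_apply_eq_zero]
  · intro z
    obtain ⟨⟨x, y⟩, rfl⟩ := hs.surj z
    constructor
    · intro hz
      rw [hc] at hz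
      obtain ⟨w, rfl⟩ := (hj.ex y).1 hz
      obtain ⟨b, rfl⟩ := h.surj w
      refine ⟨p (x - ψ b), ?_⟩
      rw [ha, ← sub_eq_zero, LinearMap.comp_apply, ← map_sub]
      refine (hs.ex _).2 ⟨-b, ?_⟩
      simp [ht]
    · rintro ⟨w, hw⟩
      obtain ⟨w, rfl⟩ := hi.surj w
      rw [← hw, ha, LinearMap.comp_apply, hc]
      simp
  · intro z
    obtain ⟨y, rfl⟩ := hj.surj z
    exact ⟨(LinearMap.range t).mkQ (0, y), by rw [hc]; rfl⟩

/-- third isomorphism theorem -/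
lemma third {D E : Type u} [AddCommGroup D] [Module R D] [AddCommGroup E] [Module R E]
    {i : B →ₗ[R] D} {p : D →ₗ[R] E} (h : SES f g) (hi : SES i p) :
    ∃ (X : ModuleCat.{u} R) (s : D →ₗ[R] X) (a : C →ₗ[R] X) (c : X →ₗ[R] E),
      SES (i ∘ₗ f) s ∧ SES a c := by
  have hs := ses_quot (f := i ∘ₗ f) (hi.inj.comp h.inj)
  obtain ⟨a, ha⟩ := factor h.surj ((LinearMap.range (i ∘ₗ f)).mkQ ∘ₗ i) (by
    intro x hx
    obtain ⟨y, rfl⟩ := (h.ex x).1 hx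
    exact (hs.ex _).2 ⟨y, rfl⟩)
  obtain ⟨c, hc⟩ := factor hs.surj p (by
    intro x hx
    obtain ⟨y, rfl⟩ := (hs.ex x).1 hx
    exact hi.ex.apply_apply_eq_zero _)
  refine ⟨ModuleCat.of R (D ⧸ LinearMap.range (i ∘ₗ f)), (LinearMap.range (i ∘ₗ f)).mkQ, a, c, hs,
    ?_, ?_, ?_⟩
  · rw [injective_iff_map_eq_zero]
    intro x hx
    obtain ⟨x, rfl⟩ := h.surj x
    rw [ha] at hx
    obtain ⟨b, hb⟩ := (hs.ex _).1 hx
    rw [← hi.inj hb, h.ex.apply_apply_eq_zero]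
  · intro z
    obtain ⟨x, rfl⟩ := hs.surj z
    constructor
    · intro hz
      rw [hc] at hz
      obtain ⟨w, rfl⟩ := (hi.ex x).1 hz
      exact ⟨g w, ha w⟩
    · rintro ⟨w, hw⟩
      obtain ⟨w, rfl⟩ := h.surj w
      rw [← hw, ha, LinearMap.comp_apply, hc, hi.ex.apply_apply_eq_zero]
  · intro z
    obtain ⟨y, rfl⟩ := hi.surj z
    exact ⟨(LinearMap.range (i ∘ₗ f)).mkQ y, hc y⟩

/-- All higher Ext into projectives vanish. -/
def W (R : Type u) [CommRing R] (M : Type u) [AddCommGroup M] [Module R M] : Prop :=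
  ∀ (k : ℕ) (Q : Type u) [AddCommGroup Q] [Module R Q], Module.Projective R Q → EV R (k+1) M Q

/-- Classes closed under cosyzygies. -/
def IsCls (K : ModuleCat.{u} R → Prop) : Prop :=
  ∀ X, K X → W R X ∧ ∃ (P Y : ModuleCat.{u} R) (f : X →ₗ[R] P) (g : P →ₗ[R] Y),
    Module.Projective R P ∧ SES f g ∧ K Y

/-- Coinductive version of Gorenstein projectivity. -/
def GP (R : Type u) [CommRing R] (M : Type u) [AddCommGroup M] [Module R M] : Prop :=
  ∃ K : ModuleCat.{u} R → Prop, IsCls K ∧ K (ModuleCat.of R M)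

lemma GP.w (h : GP R A) : W R A := by
  obtain ⟨K, hK, hA⟩ := h
  exact (hK _ hA).1

lemma GP.step (h : GP R A) : ∃ (P Y : ModuleCat.{u} R) (f : A →ₗ[R] P) (g : P →ₗ[R] Y),
    Module.Projective R P ∧ SES f g ∧ GP R Y := by
  obtain ⟨K, hK, hA⟩ := h
  obtain ⟨P, Y, f, g, h1, h2, h3⟩ := (hK _ hA).2
  exact ⟨P, Y, f, g, h1, h2, K, hK, h3⟩

lemma gp_of_ses (h : SES f g) (hA : W R A) (hB : Module.Projective R B) (hC : GP R C) :
    GP R A := by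
  refine ⟨fun X => X = ModuleCat.of R A ∨ GP R X, ?_, Or.inl rfl⟩
  rintro X (rfl | hX)
  · exact ⟨hA, ModuleCat.of R B, ModuleCat.of R C, f, g, hB, h, Or.inr hC⟩
  · obtain ⟨P, Y, f, g, h1, h2, h3⟩ := hX.step
    exact ⟨hX.w, P, Y, f, g, h1, h2, Or.inr h3⟩

lemma gp_ext (h : SES f g) (hA : GP R A) (hC : GP R C) : GP R B := by
  refine ⟨fun X => ∃ (A C : ModuleCat.{u} R) (f : A →ₗ[R] X) (g : X →ₗ[R] C),
    SES f g ∧ GP R A ∧ GP R C, ?_, ModuleCat.of R A, ModuleCat.of R C, f, g, h, hA, hC⟩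
  rintro X ⟨A, C, f, g, h, hA, hC⟩
  refine ⟨fun k Q _ _ hQ => h.ev_mid (hA.w k Q hQ) (hC.w k Q hQ), ?_⟩
  obtain ⟨P, A', i, p, hP, hi, hA'⟩ := hA.step
  obtain ⟨P', C', j, q, hP', hj, hC'⟩ := hC.step
  obtain ⟨ψ, hψ⟩ := h.extend (hC.w 0 P hP) i
  obtain ⟨D, t, s, a, c, h1, h2⟩ := horseshoe h hi hj ψ hψ
  exact ⟨ModuleCat.of R (P × P'), D, t, s, (inferInstance : Module.Projective R (P × P')), h1,
    A', C', a, c, h2, hA', hC'⟩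

lemma W.ker (h : SES f g) (hB : Module.Projective R B) (hC : W R C) : W R A :=
  fun k Q _ _ hQ => h.ev_left (ev_of_projective hB k) (hC (k+1) Q hQ)

lemma GP.ker (h : SES f g) (hB : Module.Projective R B) (hC : GP R C) : GP R A :=
  gp_of_ses h (hC.w.ker h hB) hB hC

lemma projective_of_fpd (hF : FPD R A) (hW : W R A) : Module.Projective R A := by
  obtain ⟨d, hd⟩ := hF
  replace hd : HasProjectiveDimensionLT (ModuleCat.of R A) (d+1) :=
    hasProjectiveDimensionLT_of_ge _ d _ (by omega)
  induction d generalizing A with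
  | zero => exact projective_of_ev (fpd_iff.1 hd 1 le_rfl)
  | succ d ih =>
    obtain ⟨P, g, hP, hg⟩ := exists_cover (R := R) A
    have h := ses_ker hg
    have hK : Module.Projective R (LinearMap.ker g) := by
      refine ih (hW.ker h hP) (fpd_iff.2 ?_)
      rintro (_ | k) hk N _ _
      · omega
      · exact h.ev_left (ev_of_projective hP k) (fpd_iff.1 hd _ (by omega) N)
    refine projective_of_ev fun N _ _ => h.ev_right_one ?_ (ev_of_projective hP 0)
    intro φ
    obtain ⟨r, hr⟩ := h.extend (hW 0 _ hK) LinearMap.id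
    exact ⟨φ ∘ₗ r, by rw [LinearMap.comp_assoc, hr, LinearMap.comp_id]⟩

lemma ev_fpd (hF : FPD R A) (hW : W R N) (k : ℕ) : EV R (k+1) N A := by
  obtain ⟨d, hd⟩ := hF
  replace hd : HasProjectiveDimensionLT (ModuleCat.of R A) (d+1) :=
    hasProjectiveDimensionLT_of_ge _ d _ (by omega)
  induction d generalizing A k with
  | zero => exact hW k A (projective_of_ev (fpd_iff.1 hd 1 le_rfl))
  | succ d ih =>
    obtain ⟨P, g, hP, hg⟩ := exists_cover (R := R) A
    have h := ses_ker hg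
    refine h.ev_co (hW k P hP) (ih _ (fpd_iff.2 ?_))
    rintro (_ | k) hk N _ _
    · omega
    · exact h.ev_left (ev_of_projective hP k) (fpd_iff.1 hd _ (by omega) N)

/-- Modules with a finite projective hull. -/
def Hull (R : Type u) [CommRing R] (M : Type u) [AddCommGroup M] [Module R M] : Prop :=
  ∃ (H G : ModuleCat.{u} R) (f : M →ₗ[R] H) (g : H →ₗ[R] G), FPD R H ∧ SES f g ∧ GP R G

lemma GP.hull (h : GP R A) : Hull R A := by
  obtain ⟨P, Y, f, g, h1, h2, h3⟩ := h.step
  exact ⟨P, Y, f, g, fpd_of_projective h1, h2, h3⟩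

lemma Hull.ext (h : SES f g) (hA : Hull R A) (hC : GP R C) : Hull R B := by
  obtain ⟨P, A', i, p, hP, hi, hA'⟩ := hA
  obtain ⟨P', C', j, q, hP', hj, hC'⟩ := hC.step
  obtain ⟨ψ, hψ⟩ := h.extend (ev_fpd hP hC.w 0) i
  obtain ⟨D, t, s, a, c, h1, h2⟩ := horseshoe h hi hj ψ hψ
  exact ⟨ModuleCat.of R (P × P'), D, t, s, (ses_prod P P').fpd_mid hP (fpd_of_projective hP'), h1,
    gp_ext h2 hA' hC'⟩

lemma Hull.sub (h : SES f g) (hB : Hull R B) (hC : GP R C) : Hull R A := by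
  obtain ⟨P, A', i, p, hP, hi, hA'⟩ := hB
  obtain ⟨X, s, a, c, h1, h2⟩ := third h hi
  exact ⟨P, X, _, s, hP, h1, gp_ext h2 hC hA'⟩

lemma Hull.right (h : SES f g) (hA : Hull R A) (hB : GP R B) : Hull R C := by
  obtain ⟨Q, B', i, p, hQ, hi, hB'⟩ := hB.step
  obtain ⟨M', s, a, c, h1, h2⟩ := third h hi
  obtain ⟨H, G, j, q, hH, hj, hG⟩ := hA
  obtain ⟨Q', G', k, r, hQ', hk, hG'⟩ := hG.step
  obtain ⟨ψ, hψ⟩ := hj.extend (hG.w 0 Q hQ) (i ∘ₗ f)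
  obtain ⟨D, t, s, a, c, h3, h4⟩ := horseshoe hj h1 hk ψ hψ
  have hD : FPD R D := h3.fpd_right hH (inferInstance : Module.Projective R (Q × Q'))
  exact Hull.sub h2 ⟨D, G', a, c, hD, h4, hG'⟩ hB'

lemma Hull.left (h : SES f g) (hB : GP R B) (hC : Hull R C) : Hull R A := by
  obtain ⟨Q, B', i, p, hQ, hi, hB'⟩ := hB.step
  obtain ⟨M', s, a, c, h1, h2⟩ := third h hi
  obtain ⟨H, G, j, q, hH, hj, hG⟩ := hC.ext h2 hB'
  obtain ⟨P, π, hP, hπ⟩ := exists_cover (R := R) H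
  have hS := ses_ker (g := q ∘ₗ π) (hj.surj.comp hπ)
  have hSG : GP R (LinearMap.ker (q ∘ₗ π)) := hG.ker hS hP
  let θ : Q × P →ₗ[R] H := (j ∘ₗ s).coprod π
  have hθa : ∀ x y, θ (x, y) = j (s x) + π y := fun x y => by simp [θ]
  have hθ : Function.Surjective θ := fun z => by
    obtain ⟨y, rfl⟩ := hπ z
    exact ⟨(0, y), by simp [hθa]⟩
  have hN := ses_ker hθ
  have hNF : FPD R (LinearMap.ker θ) :=
    hN.fpd_left hH (inferInstance : Module.Projective R (Q × P))
  let u : A →ₗ[R] LinearMap.ker θ :=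
    (LinearMap.inl R Q P ∘ₗ (i ∘ₗ f)).codRestrict (LinearMap.ker θ) (fun x => by
      have := h1.ex.apply_apply_eq_zero x
      simp only [LinearMap.comp_apply] at this
      simp [hθa, this])
  let v : LinearMap.ker θ →ₗ[R] LinearMap.ker (q ∘ₗ π) :=
    (LinearMap.snd R Q P ∘ₗ (LinearMap.ker θ).subtype).codRestrict _ (by
      rintro ⟨⟨x, y⟩, hxy⟩
      rw [LinearMap.mem_ker, hθa] at hxy
      have := congrArg q hxy
      rw [map_add, hj.ex.apply_apply_eq_zero, zero_add, map_zero] at this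
      exact this)
  refine ⟨ModuleCat.of R (LinearMap.ker θ), ModuleCat.of R (LinearMap.ker (q ∘ₗ π)), u, v, hNF,
    ⟨?_, ?_, ?_⟩, hSG⟩
  · intro x y hxy
    have := congrArg (fun z : LinearMap.ker θ => z.1.1) hxy
    exact h1.inj this
  · rintro ⟨⟨x, y⟩, hxy⟩
    rw [LinearMap.mem_ker, hθa] at hxy
    constructor
    · intro hz
      have hy : y = 0 := congrArg Subtype.val hz
      subst hy
      rw [map_zero, add_zero] at hxy
      obtain ⟨w, hw⟩ := (h1.ex x).1 (hj.inj (hxy.trans (map_zero j).symm))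
      refine ⟨w, Subtype.ext ?_⟩
      exact Prod.ext hw rfl
    · rintro ⟨w, hw⟩
      have := congrArg (fun z : LinearMap.ker θ => z.1.2) hw
      exact Subtype.ext this.symm
  · rintro ⟨y, hy⟩
    obtain ⟨m, hm⟩ := (hj.ex (π y)).1 hy
    obtain ⟨x, rfl⟩ := h1.surj m
    exact ⟨⟨(-x, y), by rw [LinearMap.mem_ker, hθa, map_neg, map_neg, hm, neg_add_cancel]⟩, rfl⟩

lemma Hull.gp (h : Hull R A) (hW : W R A) : GP R A := by
  obtain ⟨H, G, f, g, hH, hf, hG⟩ := h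
  exact gp_of_ses hf hW (projective_of_fpd hH
    fun k Q _ _ hQ => hf.ev_mid (hW k Q hQ) (hG.w k Q hQ)) hG

/-- cokernel in a totally acyclic complex -/
def CK (X : ModuleCat.{u} R) : Prop :=
  ∃ L : ModComplex R, L.Acyclic ∧ (∀ i, Module.Projective R (L.X i)) ∧
    (∀ (Q : Type u) [AddCommGroup Q] [Module R Q],
      Module.Projective R Q → L.HomAcyclic Q) ∧
    ∃ (i : ℤ) (f : L.X i →ₗ[R] X), Function.Surjective f ∧ LinearMap.ker f = LinearMap.range (L.d i)

lemma gp_of_isGP (h : IsGorensteinProjective R A) : GP R A := by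
  refine ⟨CK, ?_, ?_⟩
  · rintro X ⟨L, hL, hP, hH, i, f, hf, hk⟩
    constructor
    · intro k Q _ _ hQ
      induction k generalizing X i with
      | zero =>
        refine (ses_ker hf).ev_right_one ?_ (ev_of_projective (hP i) 0)
        intro φ
        have hmem : ∀ x, L.d i x ∈ LinearMap.ker f := fun x => hk ▸ ⟨x, rfl⟩
        obtain ⟨ψ, hψ⟩ := (hH Q hQ i (φ ∘ₗ (L.d i).codRestrict _ hmem)).1 (by
          ext x
          have h0 : (L.d i) (L.d (i+1) x) = 0 := LinearMap.congr_fun (L.dd i) x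
          have : (L.d i).codRestrict _ hmem (L.d (i+1) x) = 0 := Subtype.ext h0
          simp only [LinearMap.comp_apply, this, map_zero, LinearMap.zero_apply])
        refine ⟨ψ, ?_⟩
        ext ⟨x, hx⟩
        have hx' := hx
        rw [hk] at hx'
        obtain ⟨y, rfl⟩ := hx'
        exact LinearMap.congr_fun hψ y
      | succ k ih =>
        refine (ses_ker hf).ev_right ?_ (ev_of_projective (hP i) _)
        have hmem : ∀ x, L.d i x ∈ LinearMap.ker f := fun x => hk ▸ ⟨x, rfl⟩
        refine ih (ModuleCat.of R (LinearMap.ker f)) (i+1) ((L.d i).codRestrict _ hmem) ?_ ?_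
        · rintro ⟨x, hx⟩
          have hx' := hx
          rw [hk] at hx'
          obtain ⟨y, rfl⟩ := hx'
          exact ⟨y, rfl⟩
        · rw [LinearMap.ker_codRestrict]
          exact (hL i).linearMap_ker_eq
    · obtain ⟨j, rfl⟩ : ∃ j, i = j + 1 := ⟨i - 1, by omega⟩
      obtain ⟨ι, hι⟩ := factor hf (L.d j) (by
        intro x hx
        have : x ∈ LinearMap.ker f := hx
        rw [hk] at this
        exact (hL j x).2 this)
      have hr : LinearMap.range ι = LinearMap.range (L.d j) := by
        ext y
        constructor
        · rintro ⟨x, rfl⟩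
          obtain ⟨x, rfl⟩ := hf x
          exact ⟨x, (hι x).symm⟩
        · rintro ⟨x, rfl⟩
          exact ⟨f x, hι x⟩
      refine ⟨ModuleCat.of R (L.X j), ModuleCat.of R (L.X j ⧸ LinearMap.range ι), ι,
        (LinearMap.range ι).mkQ, hP j, ses_quot ?_, L, hL, hP, hH, j, (LinearMap.range ι).mkQ,
        Submodule.mkQ_surjective _, ?_⟩
      · rw [injective_iff_map_eq_zero]
        intro x hx
        obtain ⟨x, rfl⟩ := hf x
        rw [hι] at hx
        have : x ∈ LinearMap.range (L.d (j+1)) := (hL j x).1 hx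
        rw [← hk] at this
        exact this
      · rw [Submodule.ker_mkQ, hr]
  · obtain ⟨L, hL, hP, hH, f, hf⟩ := h
    exact ⟨L, hL, hP, hH, 0, f, hf⟩

lemma exists_syz (X : {X : ModuleCat.{u} R // GP R X}) : ∃ Y : {X : ModuleCat.{u} R // GP R X},
    ∃ (P : ModuleCat.{u} R) (f : Y.1 →ₗ[R] P) (g : P →ₗ[R] X.1),
      Module.Projective R P ∧ SES f g := by
  obtain ⟨P, g, hP, hg⟩ := exists_cover (R := R) X.1
  exact ⟨⟨ModuleCat.of R (LinearMap.ker g), X.2.ker (ses_ker hg) hP⟩, P, _, g, hP, ses_ker hg⟩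

lemma exists_cosyz (X : {X : ModuleCat.{u} R // GP R X}) : ∃ Y : {X : ModuleCat.{u} R // GP R X},
    ∃ (P : ModuleCat.{u} R) (f : X.1 →ₗ[R] P) (g : P →ₗ[R] Y.1),
      Module.Projective R P ∧ SES f g := by
  obtain ⟨P, Y, f, g, hP, hf, hY⟩ := X.2.step
  exact ⟨⟨Y, hY⟩, P, f, g, hP, hf⟩

lemma isGP_of_gp (h : GP R A) : IsGorensteinProjective R A := by
  choose S hS using exists_syz (R := R)
  choose T hT using exists_cosyz (R := R)
  let X0 : {X : ModuleCat.{u} R // GP R X} := ⟨ModuleCat.of R A, h⟩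
  let Z : ℤ → {X : ModuleCat.{u} R // GP R X} := fun i => match i with
    | Int.ofNat n => S^[n] X0
    | Int.negSucc n => T^[n+1] X0
  have hZ : ∀ i : ℤ, ∃ (P : ModuleCat.{u} R) (f : (Z (i+1)).1 →ₗ[R] P) (g : P →ₗ[R] (Z i).1),
      Module.Projective R P ∧ SES f g := by
    intro i
    match i with
    | Int.ofNat n =>
      have : Z (Int.ofNat n + 1) = S (Z (Int.ofNat n)) := Function.iterate_succ_apply' S n X0
      rw [this]
      exact hS _
    | Int.negSucc 0 => exact hT X0
    | Int.negSucc (n+1) =>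
      have : Z (Int.negSucc (n+1)) = T (Z (Int.negSucc (n+1) + 1)) :=
        Function.iterate_succ_apply' T (n+1) X0
      rw [this]
      exact hT _
  have h0 : Z 0 = X0 := rfl
  clear_value Z
  choose P ι π hP hE using hZ
  refine ⟨⟨fun i => P i, fun i => ι i ∘ₗ π (i+1), ?_⟩, ?_, hP, ?_, ?_⟩
  · intro i
    ext x
    simp [(hE (i+1)).ex.apply_apply_eq_zero]
  · intro i x
    change ι i (π (i+1) x) = 0 ↔ x ∈ Set.range (fun y => ι (i+1) (π (i+1+1) y))
    rw [map_eq_zero_iff _ (hE i).inj, (hE (i+1)).ex x]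
    constructor
    · rintro ⟨y, rfl⟩
      obtain ⟨y, rfl⟩ := (hE (i+1+1)).surj y
      exact ⟨y, rfl⟩
    · rintro ⟨y, rfl⟩
      exact ⟨_, rfl⟩
  · intro Q _ _ hQ i φ
    constructor
    · intro hφ
      obtain ⟨ψ, hψ⟩ := factor (hE (i+1)).surj φ (by
        intro x hx
        obtain ⟨y, rfl⟩ := ((hE (i+1)).ex x).1 hx
        obtain ⟨y, rfl⟩ := (hE (i+1+1)).surj y
        exact LinearMap.congr_fun hφ y)
      obtain ⟨χ, hχ⟩ := (hE i).extend ((Z i).2.w 0 Q hQ) ψ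
      refine ⟨χ, ?_⟩
      ext x
      exact (LinearMap.congr_fun hχ _).trans (hψ x)
    · rintro ⟨χ, rfl⟩
      ext x
      simp [(hE (i+1)).ex.apply_apply_eq_zero]
  · have key : ∀ Y : {X : ModuleCat.{u} R // GP R X}, Z 0 = Y →
        ∃ f : P 0 →ₗ[R] Y.1, Function.Surjective f ∧
          LinearMap.ker f = LinearMap.range (ι 0 ∘ₗ π (0+1)) := by
      rintro Y rfl
      refine ⟨π 0, (hE 0).surj, ?_⟩
      rw [LinearMap.range_comp_of_range_eq_top _ (LinearMap.range_eq_top.2 (hE (0+1)).surj)]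
      exact (hE 0).ex.linearMap_ker_eq
    exact key X0 h0

lemma hull_of_gProjDimLe {m : ℕ} (h : GProjDimLe R m A) : Hull R A := by
  induction m generalizing A with
  | zero => exact (gp_of_isGP h).hull
  | succ m ih =>
    obtain ⟨P, _, _, f, hP, hf, hk⟩ := h
    exact Hull.right (ses_ker hf) (ih hk) (gp_of_isGP hP)

lemma main (L : ModComplex R) (hGP : ∀ i : ℤ, 0 ≤ i → IsGorensteinProjective R (L.X i))
    (hex : ∀ i : ℤ, 0 ≤ i → Function.Exact (L.d (i + 1)) (L.d i)) (n : ℕ) :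
    ∀ (M : Type u) [AddCommGroup M] [Module R M] (j : ℤ) (_ : 0 ≤ j) (f : L.X j →ₗ[R] M)
      (_ : Function.Surjective f) (_ : LinearMap.ker f = LinearMap.range (L.d j))
      (_ : Hull R M) (_ : ∀ i, n ≤ i → ∀ (Q : Type u) [AddCommGroup Q] [Module R Q],
        Module.Projective R Q → EV R (i+1) M Q) (m : ℤ) (_ : j + n = m),
      IsGorensteinProjective R (L.X m ⧸ LinearMap.range (L.d m)) := by
  induction n with
  | zero =>
    intro M _ _ j hj f hf hk hM hE m hm
    obtain rfl : j = m := by simpa using hm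
    obtain ⟨K, h1, h2, h3, p, hp, hpk⟩ := isGP_of_gp (hM.gp fun k Q _ _ hQ => hE k k.zero_le Q hQ)
    rw [← hk]
    let e := (f.quotKerEquivOfSurjective hf).symm
    refine ⟨K, h1, h2, h3, e.toLinearMap ∘ₗ p, e.surjective.comp hp, ?_⟩
    rw [LinearEquiv.ker_comp, hpk]
  | succ n ih =>
    intro M _ _ j hj f hf hk hM hE m hm
    have hmem : ∀ x, L.d j x ∈ LinearMap.ker f := fun x => hk ▸ ⟨x, rfl⟩
    have hg := gp_of_isGP (hGP j hj)
    have hs := ses_ker hf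
    refine ih (LinearMap.ker f) (j+1) (by omega) ((L.d j).codRestrict _ hmem) ?_ ?_
      (hM.left hs hg) ?_ m (by push_cast at hm; omega)
    · rintro ⟨x, hx⟩
      have hx' := hx
      rw [hk] at hx'
      obtain ⟨y, rfl⟩ := hx'
      exact ⟨y, rfl⟩
    · rw [LinearMap.ker_codRestrict]
      exact (hex j hj).linearMap_ker_eq
    · intro i hi Q _ _ hQ
      exact hs.ev_left (hg.w i Q hQ) (hE (i+1) (by omega) Q hQ)

end GPaux

/-- If `M` has finite Gorenstein projective dimension, has a Gorenstein
projective resolution `A`, and `Ext^i(M, Q) = 0` for all `i > n` and all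
projective `Q`, then the cokernel of `A_{n+1} → A_n` is Gorenstein
projective. -/
theorem coker_gorensteinProjective_of_ext_vanishing {R : Type u} [CommRing R]
    (M : Type u) [AddCommGroup M] [Module R M]
    (A : ModComplex R)
    (hGP : ∀ i : ℤ, 0 ≤ i → IsGorensteinProjective R (A.X i))
    (f : A.X 0 →ₗ[R] M) (hf : Function.Surjective f)
    (hker : LinearMap.ker f = LinearMap.range (A.d 0))
    (hex : ∀ i : ℤ, 0 ≤ i → Function.Exact (A.d (i + 1)) (A.d i))
    (n : ℕ)
    (hext : ∀ i : ℕ, n < i → ∀ (Q : Type u) [AddCommGroup Q] [Module R Q],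
      Module.Projective R Q →
        Subsingleton (((Ext R (ModuleCat.{u} R) i).obj
          (Opposite.op (ModuleCat.of R M))).obj (ModuleCat.of R Q)))
    (hfin : ∃ m : ℕ, GProjDimLe R m M) :
    IsGorensteinProjective R (A.X (n : ℤ) ⧸ LinearMap.range (A.d (n : ℤ))) := by

  obtain ⟨m, hm⟩ := hfin
  refine GPaux.main A hGP hex n M 0 le_rfl f hf hker (GPaux.hull_of_gProjDimLe hm) ?_ n (by simp)
  intro i hi Q _ _ hQ
  exact GPaux.ev_of_ext (hext (i+1) (by omega) Q hQ)
end
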